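/- Let a be a real number with a ∉ {1/2, 1} such that 7/2 − 2a is not a nonpositive integer and neither 8/3 − 2a, 7/3 − 2a, nor 6 − 6a is a nonpositive integer. Then ₂F₁(a, a+1/2; 7/2−2a | −1/3) = (6^{1−2a}/((1−2a)(2−2a))) · { Γ(8/3−2a)/Γ(5/3) − Γ(7/3−2a)/Γ(4/3) } · Γ(6−4a)/Γ(6−6a). -/

import Mathlib

open Polynomial Real

lemma convexOn_log_Gamma_div_three_add {c : ℝ} (hc : 0 ≤ c) :
    ConvexOn ℝ (Set.Ioi 0) fun s : ℝ => log (Gamma (s / 3 + c)) := by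
  refine ⟨convex_Ioi 0, fun x hx y hy a b ha hb hab => ?_⟩
  rw [Set.mem_Ioi] at hx hy
  have h := convexOn_log_Gamma.2 (x := x / 3 + c) (y := y / 3 + c)
    (Set.mem_Ioi.2 (by positivity)) (Set.mem_Ioi.2 (by positivity)) ha hb hab
  have e : a • (x / 3 + c) + b • (y / 3 + c) = (a • x + b • y) / 3 + c := by
    simp only [smul_eq_mul]
    linear_combination c * hab
  rw [e] at h
  exact h

/-- Gauss's multiplication formula with three factors, at a positive argument. -/
lemma Gamma_triplication_of_pos {s : ℝ} (hs : 0 < s) :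
    Gamma s * Gamma (s + 1 / 3) * Gamma (s + 2 / 3) =
      Gamma (3 * s) * 3 ^ (1 - 3 * s) * (Gamma (1 / 3) * Gamma (2 / 3)) := by
  set K := Gamma (1 / 3) * Gamma (2 / 3) with hK
  have hKpos : 0 < K := mul_pos (Gamma_pos_of_pos (by norm_num)) (Gamma_pos_of_pos (by norm_num))
  clear_value K
  let f : ℝ → ℝ := fun s =>
    Gamma (s / 3) * Gamma (s / 3 + 1 / 3) * Gamma (s / 3 + 2 / 3) * 3 ^ (s - 1) / K
  have hfpos : ∀ {y : ℝ}, 0 < y → 0 < f y := fun {y} hy => by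
    have h1 := Gamma_pos_of_pos (s := y / 3) (by positivity)
    have h2 := Gamma_pos_of_pos (s := y / 3 + 1 / 3) (by positivity)
    have h3 := Gamma_pos_of_pos (s := y / 3 + 2 / 3) (by positivity)
    positivity
  have hfadd : ∀ {y : ℝ}, 0 < y → f (y + 1) = y * f y := fun {y} hy => by
    simp only [f]
    rw [show (y + 1) / 3 = y / 3 + 1 / 3 by ring,
      show y / 3 + 1 / 3 + 1 / 3 = y / 3 + 2 / 3 by ring,
      show y / 3 + 1 / 3 + 2 / 3 = y / 3 + 1 by ring, Gamma_add_one (by positivity),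
      show y + 1 - 1 = y - 1 + 1 by ring, rpow_add three_pos, rpow_one]
    ring
  have hfone : f 1 = 1 := by
    simp only [f]
    rw [show (1 / 3 : ℝ) + 1 / 3 = 2 / 3 by norm_num, show (1 / 3 : ℝ) + 2 / 3 = 1 by norm_num]
    simp [← hK, hKpos.ne', -one_div]
  have hconv : ConvexOn ℝ (Set.Ioi 0) (log ∘ f) := by
    have h0 := convexOn_log_Gamma_div_three_add (le_refl 0)
    have h1 := convexOn_log_Gamma_div_three_add (c := 1 / 3) (by norm_num)
    have h2 := convexOn_log_Gamma_div_three_add (c := 2 / 3) (by norm_num)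
    have h3 := (convexOn_id (convex_Ioi (0 : ℝ))).smul (log_pos (x := 3) (by norm_num)).le
    refine ((((h0.add h1).add h2).add h3).add_const (-log 3 - log K)).congr fun y hy => ?_
    rw [Set.mem_Ioi] at hy
    have h1 := Gamma_pos_of_pos (s := y / 3) (by positivity)
    have h2 := Gamma_pos_of_pos (s := y / 3 + 1 / 3) (by positivity)
    have h3 := Gamma_pos_of_pos (s := y / 3 + 2 / 3) (by positivity)
    simp only [Function.comp_apply, f, Pi.add_apply, add_zero, id, smul_eq_mul]
    rw [log_div (by positivity) (by positivity), log_mul (by positivity) (by positivity),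
      log_mul (by positivity) (by positivity), log_mul (by positivity) (by positivity),
      log_rpow three_pos]
    ring
  have h := eq_Gamma_of_log_convex hconv hfadd hfpos hfone (x := 3 * s)
    (Set.mem_Ioi.2 (by positivity))
  rw [← h]
  simp only [f]
  rw [show 3 * s / 3 = s by ring, show 1 - 3 * s = -(3 * s - 1) by ring, rpow_neg three_pos.le]
  have : (0 : ℝ) < 3 ^ (3 * s - 1) := by positivity
  field_simp

/-- Gauss's multiplication formula with three factors, away from the poles. -/
lemma Gamma_triplication {s : ℝ} (hs : ∀ k : ℕ, 3 * s ≠ -k) :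
    Gamma s * Gamma (s + 1 / 3) * Gamma (s + 2 / 3) =
      Gamma (3 * s) * 3 ^ (1 - 3 * s) * (Gamma (1 / 3) * Gamma (2 / 3)) := by
  obtain ⟨n, hn⟩ := exists_nat_gt (-s)
  induction n generalizing s with
  | zero => exact Gamma_triplication_of_pos (by simpa using hn)
  | succ n ih =>
    have h0 : s ≠ 0 := fun h => hs 0 (by simp [h])
    have h1 : s + 1 / 3 ≠ 0 := fun h => hs 1 (by push_cast; linarith)
    have h2 : s + 2 / 3 ≠ 0 := fun h => hs 2 (by push_cast; linarith)
    have h := ih (s := s + 1)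
      (fun k hk => hs (k + 3) (by push_cast; linarith)) (by push_cast at hn; linarith)
    rw [show s + 1 + 1 / 3 = s + 1 / 3 + 1 by ring, show s + 1 + 2 / 3 = s + 2 / 3 + 1 by ring,
      Gamma_add_one h0, Gamma_add_one h1, Gamma_add_one h2,
      show 3 * (s + 1) = 3 * s + 1 + 1 + 1 by ring,
      Gamma_add_one (s := 3 * s + 1 + 1) (by contrapose! h2; linarith),
      Gamma_add_one (s := 3 * s + 1) (by contrapose! h1; linarith),
      Gamma_add_one (s := 3 * s) (by contrapose! h0; linarith),
      show 1 - (3 * s + 1 + 1 + 1) = (1 - 3 * s) - 3 by ring, rpow_sub three_pos] at h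
    have h27 : (3 : ℝ) ^ (3 : ℝ) = 27 := by norm_num
    rw [h27] at h
    refine mul_left_cancel₀ (mul_ne_zero (mul_ne_zero h0 h1) h2) ?_
    linear_combination h

/-- The Beta integral after the substitution `t = u ^ q`. -/
lemma integral_pow_mul_one_sub_pow_rpow {q : ℕ} (hq : 0 < q) (m : ℕ) {p : ℝ} (hp : 0 < p) :
    ∫ u in (0 : ℝ)..1, u ^ m * (1 - u ^ q) ^ p =
      Gamma ((m + 1) / q) * Gamma (p + 1) / Gamma ((m + 1) / q + (p + 1)) / q := by
  have hq' : (0 : ℝ) < q := by exact_mod_cast hq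
  set s : ℝ := (m + 1) / q with hs
  have hspos : 0 < s := by positivity
  have hbeta : ∫ t in Set.Ioo (0 : ℝ) 1, t ^ (s - 1) * (1 - t) ^ p =
      Gamma s * Gamma (p + 1) / Gamma (s + (p + 1)) := by
    have h := ProbabilityTheory.beta_eq_betaIntegralReal s (p + 1) hspos (by positivity)
    have hc : Complex.betaIntegral s (p + 1 : ℝ) =
        ((∫ t in (0 : ℝ)..1, t ^ (s - 1) * (1 - t) ^ p : ℝ) : ℂ) := by
      rw [Complex.betaIntegral, ← intervalIntegral.integral_ofReal]
      refine intervalIntegral.integral_congr fun t ht => ?_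
      rw [Set.uIcc_of_le zero_le_one] at ht
      have h1 : 0 ≤ 1 - t := by linarith [ht.2]
      push_cast [Complex.ofReal_cpow ht.1, Complex.ofReal_cpow h1]
      congr 2
      ring
    rw [hc, Complex.ofReal_re, ProbabilityTheory.beta, intervalIntegral.integral_of_le zero_le_one,
      MeasureTheory.integral_Ioc_eq_integral_Ioo] at h
    exact h.symm
  have himage : (fun u : ℝ => u ^ q) '' Set.Ioo 0 1 = Set.Ioo 0 1 := by
    ext t
    constructor
    · rintro ⟨u, hu, rfl⟩
      exact ⟨pow_pos hu.1 _, pow_lt_one₀ hu.1.le hu.2 hq.ne'⟩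
    · intro ht
      exact ⟨t ^ (q : ℝ)⁻¹, ⟨rpow_pos_of_pos ht.1 _, rpow_lt_one ht.1.le ht.2 (by positivity)⟩,
        rpow_inv_natCast_pow ht.1.le hq.ne'⟩
  have hsub := MeasureTheory.integral_image_eq_integral_abs_deriv_smul (s := Set.Ioo (0 : ℝ) 1)
    (f := fun u : ℝ => u ^ q) (f' := fun u => q * u ^ (q - 1)) measurableSet_Ioo
    (fun u _ => (hasDerivAt_pow q u).hasDerivWithinAt)
    (fun x hx y hy h => (pow_left_inj₀ hx.1.le hy.1.le hq.ne').1 h)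
    (fun t => t ^ (s - 1) * (1 - t) ^ p)
  rw [himage, hbeta] at hsub
  rw [hsub, eq_div_iff hq'.ne', intervalIntegral.integral_of_le zero_le_one,
    MeasureTheory.integral_Ioc_eq_integral_Ioo, ← MeasureTheory.integral_mul_const]
  refine MeasureTheory.setIntegral_congr_fun measurableSet_Ioo fun u hu => ?_
  have hu0 : 0 < u := hu.1
  have he : u ^ (q - 1) * (u ^ q) ^ (s - 1) = u ^ m := by
    rw [← rpow_natCast, ← rpow_natCast u q, ← rpow_mul hu0.le, ← rpow_add hu0, ← rpow_natCast u m,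
      Nat.cast_sub hq]
    congr 1
    rw [hs]
    field_simp
    push_cast
    ring
  simp only [smul_eq_mul]
  rw [abs_of_pos (by positivity), ← he]
  ring

lemma norm_segment_le_one {z w : ℂ} (hz : ‖z‖ ≤ 1) (hw : ‖w‖ ≤ 1) {t : ℝ}
    (ht : t ∈ Set.Icc (0 : ℝ) 1) : ‖z + t * (w - z)‖ ≤ 1 := by
  have h := (convex_closedBall (0 : ℂ) 1) (x := z) (y := w) (by simpa) (by simpa)
    (sub_nonneg.2 ht.2) ht.1 (by ring)
  have he : (1 - t) • z + t • w = z + t * (w - z) := by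
    simp only [Complex.real_smul]
    push_cast
    ring
  rwa [mem_closedBall_zero_iff, he] at h

/-- Integrals of `f` along segments of a closed disk, as limits from smaller disks. -/
lemma tendsto_integral_segment_scaled {f : ℂ → ℂ} (hf : ContinuousOn f (Metric.closedBall 0 1))
    {z w : ℂ} (hz : ‖z‖ ≤ 1) (hw : ‖w‖ ≤ 1) :
    Filter.Tendsto (fun r : ℝ => ∫ t in (0 : ℝ)..1, f (r * (z + t * (w - z))))
      (nhdsWithin 1 (Set.Ico 0 1)) (nhds (∫ t in (0 : ℝ)..1, f (z + t * (w - z)))) := by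
  have hmem : ∀ r ∈ Set.Icc (0 : ℝ) 1, ∀ t ∈ Set.Icc (0 : ℝ) 1,
      (r : ℂ) * (z + t * (w - z)) ∈ Metric.closedBall (0 : ℂ) 1 := fun r hr t ht => by
    rw [mem_closedBall_zero_iff, norm_mul, Complex.norm_real, norm_of_nonneg hr.1]
    exact mul_le_one₀ hr.2 (norm_nonneg _) (norm_segment_le_one hz hw ht)
  obtain ⟨M, hM⟩ := (isCompact_closedBall (0 : ℂ) 1).exists_bound_of_continuousOn hf
  have hev : ∀ᶠ r : ℝ in nhdsWithin 1 (Set.Ico 0 1), r ∈ Set.Icc (0 : ℝ) 1 :=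
    Filter.mem_of_superset self_mem_nhdsWithin Set.Ico_subset_Icc_self
  have hIoc : ∀ t ∈ Set.uIoc (0 : ℝ) 1, t ∈ Set.Icc (0 : ℝ) 1 := fun t ht => by
    rw [Set.uIoc_of_le zero_le_one] at ht
    exact ⟨ht.1.le, ht.2⟩
  refine intervalIntegral.tendsto_integral_filter_of_dominated_convergence (fun _ => M) ?_ ?_
    intervalIntegrable_const ?_
  · filter_upwards [hev] with r hr
    refine ContinuousOn.aestronglyMeasurable ?_ measurableSet_uIoc
    exact hf.comp (by fun_prop) fun t ht => hmem r hr t (hIoc t ht)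
  · filter_upwards [hev] with r hr
    exact Filter.Eventually.of_forall fun t ht => hM _ (hmem r hr t (hIoc t ht))
  · refine Filter.Eventually.of_forall fun t ht => ?_
    have h1 := hmem 1 (by simp) t (hIoc t ht)
    have hc : ContinuousWithinAt (fun r : ℝ => f (r * (z + t * (w - z)))) (Set.Icc 0 1) 1 :=
      ContinuousWithinAt.comp (t := Metric.closedBall 0 1) (hf _ h1) (by fun_prop)
        fun r hr => hmem r hr t (hIoc t ht)
    simpa using (hc.mono Set.Ico_subset_Icc_self).tendsto

/-- Cauchy's theorem for a triangle with one vertex at the centre of the unit disk, for a function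
holomorphic in the disk and continuous up to the boundary. -/
lemma integral_segment_eq_sub_of_differentiableOn_ball {f : ℂ → ℂ}
    (hf : ContinuousOn f (Metric.closedBall 0 1)) (hd : DifferentiableOn ℂ f (Metric.ball 0 1))
    {z w : ℂ} (hz : ‖z‖ ≤ 1) (hw : ‖w‖ ≤ 1) :
    (w - z) * ∫ t in (0 : ℝ)..1, f (z + t * (w - z)) =
      w * (∫ t in (0 : ℝ)..1, f (t * w)) - z * ∫ t in (0 : ℝ)..1, f (t * z) := by
  obtain ⟨g, hg⟩ := hd.isExactOn_ball
  have hprim : ∀ r ∈ Set.Ico (0 : ℝ) 1, ∀ z w : ℂ, ‖z‖ ≤ 1 → ‖w‖ ≤ 1 →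
      r * ((w - z) * ∫ t in (0 : ℝ)..1, f (r * (z + t * (w - z)))) = g (r * w) - g (r * z) := by
    intro r hr z w hz hw
    have hmem : ∀ t ∈ Set.uIcc (0 : ℝ) 1, (r : ℂ) * (z + t * (w - z)) ∈ Metric.ball (0 : ℂ) 1 := by
      intro t ht
      rw [Set.uIcc_of_le zero_le_one] at ht
      rw [mem_ball_zero_iff, norm_mul, Complex.norm_real, norm_of_nonneg hr.1]
      exact (mul_le_of_le_one_right hr.1 (norm_segment_le_one hz hw ht)).trans_lt hr.2
    have h := intervalIntegral.integral_eq_sub_of_hasDerivAt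
      (f := fun t : ℝ => g (r * (z + t * (w - z))))
      (f' := fun t : ℝ => f (r * (z + t * (w - z))) * (r * (w - z))) (a := 0) (b := 1)
      (fun t ht => by
        have h1 : HasDerivAt (fun t : ℝ => (r : ℂ) * (z + t * (w - z))) (r * (w - z)) t := by
          have h2 := (Complex.ofRealCLM.hasDerivAt (x := t)).mul_const (w - z)
          simpa using (h2.const_add z).const_mul (r : ℂ)
        exact HasDerivAt.comp t (hg _ (hmem t ht)) h1)
      (ContinuousOn.intervalIntegrable
        ((hd.continuousOn.comp (by fun_prop) hmem).mul continuousOn_const))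
    rw [intervalIntegral.integral_mul_const] at h
    simp only [Complex.ofReal_one, Complex.ofReal_zero, one_mul, zero_mul, add_zero,
      add_sub_cancel] at h
    rw [← h]
    ring
  have hne : (nhdsWithin (1 : ℝ) (Set.Ico 0 1)).NeBot := by
    rw [nhdsWithin_Ico_eq_nhdsLT one_pos]
    infer_instance
  have hid : Filter.Tendsto (fun r : ℝ => (r : ℂ)) (nhdsWithin 1 (Set.Ico 0 1)) (nhds 1) := by
    have h : Filter.Tendsto (fun r : ℝ => (r : ℂ)) (nhds 1) (nhds ((1 : ℝ) : ℂ)) :=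
      Complex.continuous_ofReal.tendsto 1
    rw [Complex.ofReal_one] at h
    exact h.mono_left nhdsWithin_le_nhds
  have hlim : ∀ z w : ℂ, ‖z‖ ≤ 1 → ‖w‖ ≤ 1 → Filter.Tendsto
      (fun r : ℝ => g (r * w) - g (r * z)) (nhdsWithin 1 (Set.Ico 0 1))
      (nhds ((w - z) * ∫ t in (0 : ℝ)..1, f (z + t * (w - z)))) := by
    intro z w hz hw
    have h := hid.mul ((tendsto_integral_segment_scaled hf hz hw).const_mul (w - z))
    rw [one_mul] at h
    refine h.congr' ?_
    filter_upwards [self_mem_nhdsWithin] with r hr using hprim r hr z w hz hw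
  have hzw := hlim z w hz hw
  have h0w := hlim 0 w (by simp) hw
  have h0z := hlim 0 z (by simp) hz
  have h := tendsto_nhds_unique hzw ((h0w.sub h0z).congr fun r => by ring)
  simpa using h

lemma ofReal_mul_cpow_of_nonneg {r : ℝ} (hr : 0 ≤ r) (w : ℂ) {p : ℝ} (hp : 0 < p) :
    ((r : ℂ) * w) ^ (p : ℂ) = ((r ^ p : ℝ) : ℂ) * w ^ (p : ℂ) := by
  have hp' : (p : ℂ) ≠ 0 := by exact_mod_cast hp.ne'
  rcases hr.eq_or_lt with rfl | hr
  · simp [hp', zero_rpow hp.ne']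
  rcases eq_or_ne w 0 with rfl | hw
  · simp [hp']
  have hr' : (r : ℂ) ≠ 0 := by exact_mod_cast hr.ne'
  rw [Complex.ofReal_cpow hr.le, Complex.cpow_def_of_ne_zero (mul_ne_zero hr' hw),
    Complex.cpow_def_of_ne_zero hr', Complex.cpow_def_of_ne_zero hw, Complex.log_ofReal_mul hr hw,
    Complex.ofReal_log hr.le, ← Complex.exp_add]
  ring_nf

lemma continuousOn_one_sub_cube_cpow {p : ℝ} (hp : 0 < p) :
    ContinuousOn (fun s : ℂ => (1 + s + s ^ 2) ^ 2 * (1 - s ^ 3) ^ (p : ℂ))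
      (Metric.closedBall 0 1) := by
  intro s hs
  rw [mem_closedBall_zero_iff] at hs
  have hre : (s ^ 3).re ≤ 1 :=
    (Complex.re_le_norm _).trans (by rw [norm_pow]; exact pow_le_one₀ (norm_nonneg _) hs)
  refine ContinuousAt.continuousWithinAt (ContinuousAt.mul (by fun_prop) ?_)
  exact ContinuousAt.comp (g := fun z : ℂ => z ^ (p : ℂ)) (f := fun s : ℂ => 1 - s ^ 3)
    (Complex.continuousAt_cpow_const_of_re_pos (Or.inl (by simpa using hre)) (by simpa using hp))
    (by fun_prop)

lemma differentiableOn_one_sub_cube_cpow (p : ℝ) :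
    DifferentiableOn ℂ (fun s : ℂ => (1 + s + s ^ 2) ^ 2 * (1 - s ^ 3) ^ (p : ℂ))
      (Metric.ball 0 1) := by
  intro s hs
  rw [mem_ball_zero_iff] at hs
  have hmem : 1 - s ^ 3 ∈ Complex.slitPlane := by
    rw [sub_eq_add_neg]
    refine Complex.mem_slitPlane_of_norm_lt_one ?_
    rw [norm_neg, norm_pow]
    exact pow_lt_one₀ (norm_nonneg _) hs three_ne_zero
  refine DifferentiableAt.differentiableWithinAt (DifferentiableAt.mul (by fun_prop) ?_)
  exact DifferentiableAt.cpow_const (by fun_prop) hmem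

lemma ofReal_sqrt_three_sq : ((√3 : ℝ) : ℂ) ^ 2 = 3 := by
  rw [← Complex.ofReal_pow, sq_sqrt (by norm_num)]
  norm_num

/-- The integrand on a side of the equilateral triangle inscribed in the unit circle. -/
lemma one_sub_cube_cpow_on_side {p x : ℝ} (hp : 0 < p) (hx : x ^ 2 ≤ 1) {s : ℂ}
    (hs : s = -1 / 2 + Complex.I * √3 / 2 * x) :
    (1 + s + s ^ 2) ^ 2 * (1 - s ^ 3) ^ (p : ℂ) = ((9 / 16 * (9 / 8) ^ p : ℝ) : ℂ) *
      (((1 - x ^ 2) ^ (2 + p) : ℝ) * (1 - Complex.I * x / √3) ^ (p : ℂ)) := by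
  have h3 : ((√3 : ℝ) : ℂ) ≠ 0 := by
    intro h
    have := ofReal_sqrt_three_sq
    rw [h] at this
    norm_num at this
  have hI := Complex.I_sq
  have hsq := ofReal_sqrt_three_sq
  have e1 : 1 + s + s ^ 2 = ((3 / 4 * (1 - x ^ 2) : ℝ) : ℂ) := by
    rw [hs]
    push_cast
    linear_combination (√3 : ℂ) ^ 2 * x ^ 2 / 4 * hI - x ^ 2 / 4 * hsq
  have e2 : 1 - s ^ 3 = ((9 / 8 * (1 - x ^ 2) : ℝ) : ℂ) * (1 - Complex.I * x / √3) := by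
    have h1 : 1 - s = 3 / 2 * (1 - Complex.I * x / √3) := by
      rw [hs]
      field_simp
      linear_combination (-Complex.I * x) * hsq
    have h2 : 1 - s ^ 3 = (1 - s) * (1 + s + s ^ 2) := by ring
    rw [h2, e1, h1]
    push_cast
    ring
  have hnn : 0 ≤ 1 - x ^ 2 := by linarith
  rw [e1, e2, ofReal_mul_cpow_of_nonneg (by positivity) _ hp, mul_rpow (by norm_num) hnn,
    rpow_add_of_nonneg hnn (by norm_num) hp.le, rpow_two]
  push_cast
  ring

/-- The integrand on the rays towards two vertices of the equilateral triangle. -/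
lemma one_sub_cube_cpow_on_rays {p t : ℝ} {ζ ξ : ℂ} (ht0 : 0 ≤ t) (ht : t ≤ 1)
    (hζ : ζ = -1 / 2 + Complex.I * √3 / 2) (hξ : ξ = -1 / 2 - Complex.I * √3 / 2) :
    ζ * ((1 + t * ζ + (t * ζ) ^ 2) ^ 2 * (1 - (t * ζ) ^ 3) ^ (p : ℂ)) -
      ξ * ((1 + t * ξ + (t * ξ) ^ 2) ^ 2 * (1 - (t * ξ) ^ 3) ^ (p : ℂ)) =
    Complex.I * √3 * (((1 - t ^ 3) ^ p * (1 - 2 * t + 2 * t ^ 3 - t ^ 4) : ℝ) : ℂ) := by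
  have hI := Complex.I_sq
  have hsq := ofReal_sqrt_three_sq
  have hζ2 : ζ ^ 2 = -1 - ζ := by
    rw [hζ]
    linear_combination (√3 : ℂ) ^ 2 / 4 * hI - 1 / 4 * hsq
  have hξ2 : ξ ^ 2 = -1 - ξ := by
    rw [hξ]
    linear_combination (√3 : ℂ) ^ 2 / 4 * hI - 1 / 4 * hsq
  have hζ3 : ζ ^ 3 = 1 := by linear_combination (ζ - 1) * hζ2
  have hξ3 : ξ ^ 3 = 1 := by linear_combination (ξ - 1) * hξ2
  have hd : ζ - ξ = Complex.I * √3 := by rw [hζ, hξ]; ring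
  have hnn : 0 ≤ 1 - t ^ 3 := by linarith [pow_le_one₀ (n := 3) ht0 ht]
  have hζp : ζ * (1 + t * ζ + (t * ζ) ^ 2) ^ 2 =
      ζ + 2 * t * (-1 - ζ) + 3 * t ^ 2 + 2 * t ^ 3 * ζ + t ^ 4 * (-1 - ζ) := by
    rw [← hζ2]
    linear_combination (3 * t ^ 2 + 2 * t ^ 3 * ζ + t ^ 4 * ζ ^ 2) * hζ3
  have hξp : ξ * (1 + t * ξ + (t * ξ) ^ 2) ^ 2 =
      ξ + 2 * t * (-1 - ξ) + 3 * t ^ 2 + 2 * t ^ 3 * ξ + t ^ 4 * (-1 - ξ) := by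
    rw [← hξ2]
    linear_combination (3 * t ^ 2 + 2 * t ^ 3 * ξ + t ^ 4 * ξ ^ 2) * hξ3
  rw [← mul_assoc, ← mul_assoc, hζp, hξp, mul_pow _ ζ, mul_pow _ ξ, hζ3, hξ3, mul_one, ← hd]
  push_cast [Complex.ofReal_cpow hnn]
  ring

lemma integral_side_eq_integral_ray {p : ℝ} (hp : 0 < p) :
    ∫ x in (-1 : ℝ)..1, (((1 - x ^ 2) ^ (2 + p) : ℝ) : ℂ) * (1 - Complex.I * x / √3) ^ (p : ℂ) =
      ((32 / 9 * (8 / 9) ^ p *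
        ∫ t in (0 : ℝ)..1, (1 - t ^ 3) ^ p * (1 - 2 * t + 2 * t ^ 3 - t ^ 4) : ℝ) : ℂ) := by
  set f : ℂ → ℂ := fun s => (1 + s + s ^ 2) ^ 2 * (1 - s ^ 3) ^ (p : ℂ) with hf
  set g : ℝ → ℂ := fun x =>
    (((1 - x ^ 2) ^ (2 + p) : ℝ) : ℂ) * (1 - Complex.I * x / √3) ^ (p : ℂ) with hg
  obtain ⟨ζ, hζ⟩ : ∃ ζ : ℂ, ζ = -1 / 2 + Complex.I * √3 / 2 := ⟨_, rfl⟩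
  obtain ⟨ξ, hξ⟩ : ∃ ξ : ℂ, ξ = -1 / 2 - Complex.I * √3 / 2 := ⟨_, rfl⟩
  have hsq3 : √3 * √3 = 3 := mul_self_sqrt (by norm_num)
  have hnζ : ‖ζ‖ ≤ 1 := by
    have : Complex.normSq ζ = 1 := by
      rw [hζ, Complex.normSq_apply]
      norm_num
      nlinarith
    rw [Complex.norm_def, this, sqrt_one]
  have hnξ : ‖ξ‖ ≤ 1 := by
    have : Complex.normSq ξ = 1 := by
      rw [hξ, Complex.normSq_apply]
      norm_num
      nlinarith
    rw [Complex.norm_def, this, sqrt_one]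
  have hd : ζ - ξ = Complex.I * √3 := by rw [hζ, hξ]; ring
  have hd0 : ζ - ξ ≠ 0 := by
    rw [hd]
    refine mul_ne_zero Complex.I_ne_zero ?_
    exact_mod_cast (sqrt_pos.2 three_pos).ne'
  have hcont := continuousOn_one_sub_cube_cpow hp
  have hint : ∀ w : ℂ, ‖w‖ ≤ 1 →
      IntervalIntegrable (fun t : ℝ => f (t * w)) MeasureTheory.volume 0 1 := fun w hw => by
    refine ContinuousOn.intervalIntegrable (hcont.comp (by fun_prop) fun t ht => ?_)
    rw [Set.uIcc_of_le zero_le_one] at ht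
    simpa using norm_segment_le_one (z := 0) (by simp) hw ht
  have hcauchy := integral_segment_eq_sub_of_differentiableOn_ball hcont
    (differentiableOn_one_sub_cube_cpow p) hnξ hnζ
  have hside : ∫ t in (0 : ℝ)..1, f (ξ + t * (ζ - ξ)) =
      ((9 / 16 * (9 / 8) ^ p : ℝ) : ℂ) * ((1 / 2 : ℝ) * ∫ x in (-1 : ℝ)..1, g x) := by
    have hsub := intervalIntegral.integral_comp_mul_add (a := 0) (b := 1) g two_ne_zero (-1)
    rw [show (2 : ℝ) * 0 + -1 = -1 by norm_num, show (2 : ℝ) * 1 + -1 = 1 by norm_num] at hsub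
    rw [show (((1 / 2 : ℝ)) : ℂ) * ∫ x in (-1 : ℝ)..1, g x = (2 : ℝ)⁻¹ • ∫ x in (-1 : ℝ)..1, g x by
      rw [Complex.real_smul]; norm_num, ← hsub, ← intervalIntegral.integral_const_mul]
    refine intervalIntegral.integral_congr fun t ht => ?_
    rw [Set.uIcc_of_le zero_le_one] at ht
    refine one_sub_cube_cpow_on_side hp (by nlinarith [ht.1, ht.2]) ?_
    rw [hd, hξ]
    push_cast
    ring
  have hray : ζ * (∫ t in (0 : ℝ)..1, f (t * ζ)) - ξ * (∫ t in (0 : ℝ)..1, f (t * ξ)) =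
      (ζ - ξ) *
        ((∫ t in (0 : ℝ)..1, (1 - t ^ 3) ^ p * (1 - 2 * t + 2 * t ^ 3 - t ^ 4) : ℝ) : ℂ) := by
    rw [← intervalIntegral.integral_const_mul, ← intervalIntegral.integral_const_mul,
      ← intervalIntegral.integral_sub ((hint ζ hnζ).const_mul _) ((hint ξ hnξ).const_mul _),
      ← intervalIntegral.integral_ofReal, ← intervalIntegral.integral_const_mul]
    refine intervalIntegral.integral_congr fun t ht => ?_
    rw [Set.uIcc_of_le zero_le_one] at ht
    rw [hd]
    exact one_sub_cube_cpow_on_rays ht.1 ht.2 hζ hξ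
  change (ζ - ξ) * ∫ t in (0 : ℝ)..1, f (ξ + t * (ζ - ξ)) =
    ζ * (∫ t in (0 : ℝ)..1, f (t * ζ)) - ξ * (∫ t in (0 : ℝ)..1, f (t * ξ)) at hcauchy
  rw [hray, hside] at hcauchy
  have h := mul_left_cancel₀ hd0 hcauchy
  have hpow : (9 / 8 : ℝ) ^ p * (8 / 9) ^ p = 1 := by
    rw [← mul_rpow (by norm_num) (by norm_num)]
    norm_num
  have hpow' : (((9 / 8 : ℝ) ^ p : ℝ) : ℂ) * (((8 / 9 : ℝ) ^ p : ℝ) : ℂ) = 1 := by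
    exact_mod_cast hpow
  rw [Complex.ofReal_mul, ← h]
  push_cast at hpow' ⊢
  linear_combination (-∫ x in (-1 : ℝ)..1, g x) * hpow'

lemma integral_one_sub_cube_rpow_mul_quartic {p : ℝ} (hp : 0 < p) :
    ∫ t in (0 : ℝ)..1, (1 - t ^ 3) ^ p * (1 - 2 * t + 2 * t ^ 3 - t ^ 4) =
      Gamma (p + 1) * (2 + p) *
        (Gamma (4 / 3) / Gamma (7 / 3 + p) - Gamma (5 / 3) / Gamma (8 / 3 + p)) := by
  have hcont : ∀ m : ℕ, IntervalIntegrable (fun t : ℝ => t ^ m * (1 - t ^ 3) ^ p)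
      MeasureTheory.volume 0 1 := fun m => by
    refine Continuous.intervalIntegrable (Continuous.mul (by fun_prop) ?_) _ _
    exact Continuous.rpow_const (by fun_prop) fun _ => Or.inr hp.le
  have hsplit : ∫ t in (0 : ℝ)..1, (1 - t ^ 3) ^ p * (1 - 2 * t + 2 * t ^ 3 - t ^ 4) =
      (∫ t in (0 : ℝ)..1, t ^ 0 * (1 - t ^ 3) ^ p)
      - 2 * (∫ t in (0 : ℝ)..1, t ^ 1 * (1 - t ^ 3) ^ p)
      + 2 * (∫ t in (0 : ℝ)..1, t ^ 3 * (1 - t ^ 3) ^ p)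
      - ∫ t in (0 : ℝ)..1, t ^ 4 * (1 - t ^ 3) ^ p := by
    rw [← intervalIntegral.integral_const_mul, ← intervalIntegral.integral_const_mul,
      ← intervalIntegral.integral_sub (hcont 0) ((hcont 1).const_mul 2),
      ← intervalIntegral.integral_add ((hcont 0).sub ((hcont 1).const_mul 2))
        ((hcont 3).const_mul 2),
      ← intervalIntegral.integral_sub (((hcont 0).sub ((hcont 1).const_mul 2)).add
        ((hcont 3).const_mul 2)) (hcont 4)]
    refine intervalIntegral.integral_congr fun t _ => ?_
    ring
  have hbeta := fun m => integral_pow_mul_one_sub_pow_rpow three_pos m hp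
  have g1 : Gamma (4 / 3) = 1 / 3 * Gamma (1 / 3) := by
    rw [← Gamma_add_one (by norm_num)]; norm_num
  have g2 : Gamma (5 / 3) = 2 / 3 * Gamma (2 / 3) := by
    rw [← Gamma_add_one (by norm_num)]; norm_num
  have g3 : Gamma (7 / 3 + p) = (4 / 3 + p) * Gamma (4 / 3 + p) := by
    rw [← Gamma_add_one (by positivity)]; ring_nf
  have g4 : Gamma (8 / 3 + p) = (5 / 3 + p) * Gamma (5 / 3 + p) := by
    rw [← Gamma_add_one (by positivity)]; ring_nf
  rw [hsplit, hbeta 0, hbeta 1, hbeta 3, hbeta 4]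
  push_cast
  rw [show ((0 : ℝ) + 1) / 3 = 1 / 3 by norm_num, show ((1 : ℝ) + 1) / 3 = 2 / 3 by norm_num,
    show ((3 : ℝ) + 1) / 3 = 4 / 3 by norm_num, show ((4 : ℝ) + 1) / 3 = 5 / 3 by norm_num,
    show 1 / 3 + (p + 1) = 4 / 3 + p by ring, show 2 / 3 + (p + 1) = 5 / 3 + p by ring,
    show 4 / 3 + (p + 1) = 7 / 3 + p by ring, show 5 / 3 + (p + 1) = 8 / 3 + p by ring, g3, g4,
    g1, g2]
  have h1 : 0 < Gamma (4 / 3 + p) := Gamma_pos_of_pos (by positivity)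
  have h2 : 0 < Gamma (5 / 3 + p) := Gamma_pos_of_pos (by positivity)
  have h3 : 0 < 4 / 3 + p := by positivity
  have h4 : 0 < 5 / 3 + p := by positivity
  field_simp
  ring

/-- Even moments of the weight `(1 - x ^ 2) ^ (2 + p)`. -/
lemma integral_even_pow_mul_one_sub_sq_rpow {p : ℝ} (hp : 0 < p) (k : ℕ) :
    ∫ x in (-1 : ℝ)..1, x ^ (2 * k) * (1 - x ^ 2) ^ (2 + p) =
      Gamma (k + 1 / 2) * Gamma (3 + p) / Gamma (7 / 2 + p + k) := by
  have hc : Continuous fun x : ℝ => x ^ (2 * k) * (1 - x ^ 2) ^ (2 + p) :=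
    Continuous.mul (by fun_prop)
      (Continuous.rpow_const (by fun_prop) fun _ => Or.inr (by positivity))
  have hneg := intervalIntegral.integral_comp_neg (a := 0) (b := 1)
    (fun x : ℝ => x ^ (2 * k) * (1 - x ^ 2) ^ (2 + p))
  simp only [Even.neg_pow ⟨k, two_mul k⟩, even_two.neg_pow, neg_zero] at hneg
  rw [← intervalIntegral.integral_add_adjacent_intervals (hc.intervalIntegrable (-1) 0)
    (hc.intervalIntegrable 0 1), ← hneg,
    integral_pow_mul_one_sub_pow_rpow two_pos (2 * k) (by positivity)]
  push_cast
  rw [show (2 * (k : ℝ) + 1) / 2 = k + 1 / 2 by ring, show 2 + p + 1 = 3 + p by ring,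
    show (k : ℝ) + 1 / 2 + (3 + p) = 7 / 2 + p + k by ring]
  ring

lemma integral_odd_pow_mul_one_sub_sq_rpow (p : ℝ) {n : ℕ} (hn : Odd n) :
    ∫ x in (-1 : ℝ)..1, x ^ n * (1 - x ^ 2) ^ (2 + p) = 0 := by
  have hneg := intervalIntegral.integral_comp_neg (a := -1) (b := 1)
    (fun x : ℝ => x ^ n * (1 - x ^ 2) ^ (2 + p))
  simp only [hn.neg_pow, even_two.neg_pow, neg_neg, neg_mul, intervalIntegral.integral_neg] at hneg
  linarith

lemma choose_succ_mul (p : ℝ) (n : ℕ) :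
    Ring.choose p (n + 1) * (n + 1) = Ring.choose p n * (p - n) := by
  have h := Ring.choose_eq_smul (a := p) (n := n)
  have h' := Ring.choose_eq_smul (a := p) (n := n + 1)
  rw [descPochhammer_succ_right, Polynomial.smeval_mul] at h'
  have hf : (n.factorial : ℝ) ≠ 0 := by positivity
  rw [h, h', Nat.factorial_succ]
  simp [Polynomial.smeval_natCast]
  field_simp

/-- The even binomial coefficients of exponent `p = -2 a`. -/
lemma choose_even_mul_Gamma (a : ℝ) (k : ℕ) :
    Ring.choose (-2 * a) (2 * k) * Gamma (k + 1 / 2) =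
      √π * ((ascPochhammer ℝ k).eval a * (ascPochhammer ℝ k).eval (a + 1 / 2) /
        (Nat.factorial k : ℝ)) := by
  induction k with
  | zero => simp [-one_div, Gamma_one_half_eq]
  | succ k ih =>
    have h1 := choose_succ_mul (-2 * a) (2 * k)
    have h2 := choose_succ_mul (-2 * a) (2 * k + 1)
    push_cast at h1 h2
    have hg : Gamma ((k + 1 : ℕ) + 1 / 2) = (k + 1 / 2) * Gamma (k + 1 / 2) := by
      rw [← Gamma_add_one (by positivity)]; push_cast; ring_nf
    rw [show 2 * (k + 1) = 2 * k + 1 + 1 by ring, hg, ascPochhammer_succ_eval,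
      ascPochhammer_succ_eval, Nat.factorial_succ]
    have hf : (k.factorial : ℝ) ≠ 0 := by positivity
    have hk : (k : ℝ) + 1 ≠ 0 := by positivity
    have hk2 : 2 * (k : ℝ) + 1 ≠ 0 := by positivity
    have e1 : Ring.choose (-2 * a) (2 * k + 1) =
        Ring.choose (-2 * a) (2 * k) * (-2 * a - 2 * k) / (2 * k + 1) := by
      rw [eq_div_iff hk2, h1]
    have e2 : Ring.choose (-2 * a) (2 * k + 1 + 1) =
        Ring.choose (-2 * a) (2 * k + 1) * (-2 * a - (2 * k + 1)) / (2 * k + 1 + 1) := by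
      rw [eq_div_iff (by positivity), h2]
    have hstep : Ring.choose (-2 * a) (2 * k + 1 + 1) * ((k + 1 / 2) * Gamma (k + 1 / 2)) =
        Ring.choose (-2 * a) (2 * k) * Gamma (k + 1 / 2) *
          ((a + k) * (a + 1 / 2 + k) / (k + 1)) := by
      rw [e2, e1]
      field_simp
      ring
    rw [hstep, ih]
    push_cast
    field_simp

lemma hasSum_binomial_cpow (p : ℝ) {w : ℂ} (hw : ‖w‖ < 1) :
    HasSum (fun n : ℕ => (Ring.choose p n : ℂ) * w ^ n) ((1 + w) ^ (p : ℂ)) := by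
  have h := Complex.one_add_cpow_hasFPowerSeriesOnBall_zero (a := (p : ℂ))
  have hsum := h.hasSum (y := w)
    (by simpa [Metric.mem_eball, edist_zero_right, ← ofReal_norm] using hw)
  simpa [binomialSeries, FormalMultilinearSeries.coeff_ofScalars, mul_comm] using hsum

/-- Euler-type integral representation of the regularized hypergeometric series. -/
lemma hasSum_regularized_of_neg {a : ℝ} (ha : a < 0) :
    HasSum (fun k : ℕ => (((ascPochhammer ℝ k).eval a * (ascPochhammer ℝ k).eval (a + 1 / 2) /
        (Nat.factorial k : ℝ) / Gamma (7 / 2 - 2 * a + k) * (-1 / 3) ^ k *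
          (√π * Gamma (3 - 2 * a)) : ℝ) : ℂ))
      (∫ x in (-1 : ℝ)..1, (((1 - x ^ 2) ^ (2 + -2 * a) : ℝ) : ℂ) *
        (1 - Complex.I * x / √3) ^ ((-2 * a : ℝ) : ℂ)) := by
  set p := -2 * a with hp
  have hppos : 0 < p := by linarith
  clear_value p
  set c : ℂ := -Complex.I / √3 with hc
  have h3 : (1 : ℝ) < √3 := by
    rw [lt_sqrt zero_le_one]
    norm_num
  have hcnorm : ‖c‖ = 1 / √3 := by
    rw [hc, norm_div, norm_neg, Complex.norm_I, Complex.norm_real, norm_of_nonneg (by positivity)]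
  have hc1 : ‖c‖ < 1 := by
    rw [hcnorm, div_lt_one (by positivity)]
    exact h3
  have hcsq : c ^ 2 = -1 / 3 := by
    rw [hc, div_pow, neg_sq, Complex.I_sq, ofReal_sqrt_three_sq]
  have hIoc : ∀ x ∈ Set.uIoc (-1 : ℝ) 1, |x| ≤ 1 := fun x hx => by
    rw [Set.uIoc_of_le (by norm_num)] at hx
    exact abs_le.2 ⟨hx.1.le, hx.2⟩
  have hweight : Continuous fun x : ℝ => (1 - x ^ 2) ^ (2 + p) :=
    Continuous.rpow_const (by fun_prop) fun _ => Or.inr (by positivity)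
  have hsum := intervalIntegral.hasSum_integral_of_dominated_convergence
    (μ := MeasureTheory.volume) (a := -1) (b := 1)
    (F := fun (n : ℕ) (x : ℝ) =>
      (Ring.choose p n : ℂ) * c ^ n * ((x ^ n * (1 - x ^ 2) ^ (2 + p) : ℝ) : ℂ))
    (f := fun x : ℝ => (((1 - x ^ 2) ^ (2 + p) : ℝ) : ℂ) *
        (1 - Complex.I * x / √3) ^ (p : ℂ))
    (fun n _ => ‖(Ring.choose p n : ℂ) * c ^ n‖)
    (fun n => by
      refine Continuous.aestronglyMeasurable (Continuous.mul continuous_const ?_)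
      exact Complex.continuous_ofReal.comp (Continuous.mul (by fun_prop) hweight))
    (fun n => Filter.Eventually.of_forall fun x hx => by
      have hx1 := hIoc x hx
      have hx2 : x ^ 2 ≤ 1 := (sq_le_one_iff_abs_le_one x).2 hx1
      rw [norm_mul]
      refine mul_le_of_le_one_right (norm_nonneg _) ?_
      rw [Complex.norm_real, norm_mul, norm_pow, norm_eq_abs, norm_eq_abs]
      refine mul_le_one₀ (pow_le_one₀ (abs_nonneg _) hx1) (abs_nonneg _) ?_
      rw [abs_of_nonneg (rpow_nonneg (by linarith) _)]
      exact rpow_le_one (by linarith) (by nlinarith) (by positivity))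
    (Filter.Eventually.of_forall fun x _ => (hasSum_binomial_cpow p hc1).summable.norm)
    intervalIntegrable_const
    (Filter.Eventually.of_forall fun x hx => by
      have hx1 := hIoc x hx
      have hcx : ‖c * x‖ < 1 := by
        rw [norm_mul, Complex.norm_real, norm_eq_abs]
        exact (mul_le_of_le_one_right (norm_nonneg _) hx1).trans_lt hc1
      have h := (hasSum_binomial_cpow p hcx).mul_left (((1 - x ^ 2) ^ (2 + p) : ℝ) : ℂ)
      rw [show 1 + c * x = 1 - Complex.I * x / √3 by rw [hc]; ring] at h
      refine h.congr_fun fun n => ?_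
      rw [Complex.ofReal_mul, Complex.ofReal_pow]
      ring)
  have hterm : ∀ n : ℕ, ∫ x in (-1 : ℝ)..1,
      (Ring.choose p n : ℂ) * c ^ n * ((x ^ n * (1 - x ^ 2) ^ (2 + p) : ℝ) : ℂ) =
      (Ring.choose p n : ℂ) * c ^ n *
        ((∫ x in (-1 : ℝ)..1, x ^ n * (1 - x ^ 2) ^ (2 + p) : ℝ) : ℂ) :=
    fun n => by rw [intervalIntegral.integral_const_mul, intervalIntegral.integral_ofReal]
  simp only [hterm] at hsum
  have hinj : Function.Injective fun k : ℕ => 2 * k := mul_right_injective₀ two_ne_zero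
  rw [← hinj.hasSum_iff fun n hn => ?_] at hsum
  · refine hsum.congr_fun fun k => ?_
    simp only [Function.comp_apply]
    rw [integral_even_pow_mul_one_sub_sq_rpow hppos k, pow_mul, hcsq, ← Complex.ofReal_choose]
    have h := choose_even_mul_Gamma a k
    rw [← hp] at h
    have e : (7 / 2 - 2 * a + k) = 7 / 2 + p + k := by rw [hp]; ring
    have e' : 3 - 2 * a = 3 + p := by rw [hp]; ring
    rw [e, e', show (-1 / 3 : ℂ) = ((-1 / 3 : ℝ) : ℂ) by push_cast; rfl]
    simp only [← Complex.ofReal_pow, ← Complex.ofReal_mul]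
    congr 1
    linear_combination ((-1 / 3) ^ k * Gamma (3 + p) / Gamma (7 / 2 + p + k)) * (-h)
  · have hodd : Odd n := by
      rw [← Nat.not_even_iff_odd]
      rintro ⟨k, hk⟩
      exact hn ⟨k, by simp only; omega⟩
    rw [integral_odd_pow_mul_one_sub_sq_rpow p hodd]
    simp

lemma tsum_regularized_of_neg {a : ℝ} (ha : a < 0) :
    (1 - 2 * a) * ∑' k : ℕ, (ascPochhammer ℝ k).eval a * (ascPochhammer ℝ k).eval (a + 1 / 2) /
        (Nat.factorial k : ℝ) / Gamma (7 / 2 - 2 * a + k) * (-1 / 3) ^ k =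
      32 / 9 / √π * (9 / 8) ^ (2 * a) *
        (Gamma (4 / 3) / Gamma (7 / 3 - 2 * a) - Gamma (5 / 3) / Gamma (8 / 3 - 2 * a)) := by
  have h := hasSum_regularized_of_neg ha
  rw [integral_side_eq_integral_ray (by linarith), Complex.hasSum_ofReal] at h
  have hvalue := h.tsum_eq
  rw [tsum_mul_right, integral_one_sub_cube_rpow_mul_quartic (by linarith)] at hvalue
  have g1 : Gamma (3 - 2 * a) = (2 - 2 * a) * ((1 - 2 * a) * Gamma (1 - 2 * a)) := by
    rw [← Gamma_add_one (by linarith), show 1 - 2 * a + 1 = 2 - 2 * a by ring,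
      ← Gamma_add_one (by linarith)]
    ring_nf
  have e1 : (8 / 9 : ℝ) ^ (-2 * a) = (9 / 8) ^ (2 * a) := by
    rw [show -2 * a = -(2 * a) by ring, rpow_neg (by norm_num), ← inv_rpow (by norm_num)]
    norm_num
  rw [g1, e1, show -2 * a + 1 = 1 - 2 * a by ring, show 2 + -2 * a = 2 - 2 * a by ring,
    show 7 / 3 + -2 * a = 7 / 3 - 2 * a by ring,
    show 8 / 3 + -2 * a = 8 / 3 - 2 * a by ring] at hvalue
  have hG : Gamma (1 - 2 * a) ≠ 0 := (Gamma_pos_of_pos (by linarith)).ne'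
  have h2 : 2 - 2 * a ≠ 0 := by linarith
  have hπ : √π ≠ 0 := (sqrt_pos.2 pi_pos).ne'
  refine mul_right_cancel₀ (mul_ne_zero (mul_ne_zero hπ h2) hG) ?_
  rw [show ∀ u v : ℝ, 32 / 9 / √π * u * v * (√π * (2 - 2 * a) * Gamma (1 - 2 * a)) =
    32 / 9 * u * (Gamma (1 - 2 * a) * (2 - 2 * a) * v) from fun u v => by field_simp, ← hvalue]
  ring

/-- The terms of the series divided by `Γ(7/2 - 2a)`, which are entire in `a`. -/
noncomputable def regularizedTerm (k : ℕ) (a : ℂ) : ℂ :=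
  (ascPochhammer ℂ k).eval a * (ascPochhammer ℂ k).eval (a + 1 / 2) / (Nat.factorial k : ℂ) *
    (Complex.Gamma (7 / 2 - 2 * a + k))⁻¹ * (-1 / 3) ^ k

lemma differentiable_regularizedTerm (k : ℕ) : Differentiable ℂ (regularizedTerm k) := by
  have h1 : Differentiable ℂ fun a : ℂ => (Complex.Gamma (7 / 2 - 2 * a + k))⁻¹ :=
    Complex.differentiable_one_div_Gamma.comp (by fun_prop)
  have h2 : Differentiable ℂ fun a : ℂ => (ascPochhammer ℂ k).eval a :=
    (ascPochhammer ℂ k).differentiable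
  have h3 : Differentiable ℂ fun a : ℂ => (ascPochhammer ℂ k).eval (a + 1 / 2) :=
    h2.comp (g := fun a : ℂ => (ascPochhammer ℂ k).eval a) (by fun_prop)
  unfold regularizedTerm
  fun_prop

lemma regularizedTerm_succ (k : ℕ) (a : ℂ) :
    regularizedTerm (k + 1) a * (3 * (k + 1) * (7 / 2 - 2 * a + k)) =
      -(regularizedTerm k a * ((a + k) * (a + 1 / 2 + k))) := by
  have hg := Complex.one_div_Gamma_eq_self_mul_one_div_Gamma_add_one (7 / 2 - 2 * a + k)
  have hf : (k.factorial : ℂ) ≠ 0 := by exact_mod_cast k.factorial_ne_zero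
  have hk : (k : ℂ) + 1 ≠ 0 := by exact_mod_cast k.succ_ne_zero
  unfold regularizedTerm
  rw [hg, ascPochhammer_succ_eval, ascPochhammer_succ_eval, Nat.factorial_succ, pow_succ]
  push_cast
  rw [← add_assoc]
  field_simp

lemma norm_regularizedTerm_succ_le {R k : ℕ} (hk : 20 * (R + 1) ≤ k) {a : ℂ} (ha : ‖a‖ ≤ R) :
    ‖regularizedTerm (k + 1) a‖ ≤ 1 / 2 * ‖regularizedTerm k a‖ := by
  have hk' : 20 * ((R : ℝ) + 1) ≤ k := by exact_mod_cast hk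
  have hR : (0 : ℝ) ≤ R := R.cast_nonneg
  have h1 : ‖a + k‖ ≤ R + k := (norm_add_le _ _).trans (by simpa using ha)
  have h2 : ‖a + 1 / 2 + k‖ ≤ R + 1 / 2 + k := by
    refine (norm_add_le _ _).trans ?_
    have : ‖a + 1 / 2‖ ≤ R + 1 / 2 := (norm_add_le _ _).trans (by simpa using ha)
    simpa using this
  have h3 : k - 2 * (R : ℝ) ≤ ‖7 / 2 - 2 * a + k‖ := by
    have hre := (Complex.abs_re_le_norm a).trans ha
    have h := Complex.re_le_norm (7 / 2 - 2 * a + k)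
    have he : (7 / 2 - 2 * a + k : ℂ).re = 7 / 2 - 2 * a.re + k := by
      simp [Complex.add_re, Complex.sub_re, Complex.mul_re]
    rw [he] at h
    linarith [(abs_le.1 hre).2]
  have h := congrArg norm (regularizedTerm_succ k a)
  have hn : ‖(3 : ℂ) * (k + 1)‖ = 3 * (k + 1) := by
    have : (3 : ℂ) * (k + 1) = ((3 * (k + 1) : ℝ) : ℂ) := by push_cast; rfl
    rw [this, Complex.norm_real, norm_of_nonneg (by positivity)]
  rw [norm_neg, norm_mul, norm_mul _ (_ * _), norm_mul _ (7 / 2 - 2 * a + k : ℂ), hn,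
    norm_mul (a + k)] at h
  set D := 3 * ((k : ℝ) + 1) * ‖7 / 2 - 2 * a + k‖
  have hD : 3 * ((k : ℝ) + 1) * (k - 2 * R) ≤ D := by
    simp only [D]
    gcongr
  have hN : ‖a + k‖ * ‖a + 1 / 2 + k‖ ≤ (R + k) * (R + 1 / 2 + k) := by gcongr
  have hND : 2 * ((R + k) * (R + 1 / 2 + k)) ≤ 3 * ((k : ℝ) + 1) * (k - 2 * R) := by nlinarith
  have hkR : 0 < k - 2 * (R : ℝ) := by linarith
  have hDpos : 0 < D := lt_of_lt_of_le (by positivity) hD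
  refine le_of_mul_le_mul_right ?_ hDpos
  rw [h]
  nlinarith [norm_nonneg (regularizedTerm k a)]

lemma exists_norm_regularizedTerm_le (R : ℕ) : ∃ M : ℝ, ∀ a : ℂ, ‖a‖ ≤ R → ∀ m : ℕ,
    ‖regularizedTerm (m + 20 * (R + 1)) a‖ ≤ M * (1 / 2) ^ m := by
  obtain ⟨M, hM⟩ := (isCompact_closedBall (0 : ℂ) R).exists_bound_of_continuousOn
    (differentiable_regularizedTerm (20 * (R + 1))).continuous.continuousOn
  refine ⟨M, fun a ha m => ?_⟩
  induction m with
  | zero => simpa using hM a (by simpa using ha)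
  | succ m ih =>
    rw [show m + 1 + 20 * (R + 1) = m + 20 * (R + 1) + 1 by ring]
    refine (norm_regularizedTerm_succ_le (by omega) ha).trans ?_
    rw [pow_succ]
    linarith

lemma differentiable_tsum_regularizedTerm :
    Differentiable ℂ fun a : ℂ => ∑' k : ℕ, regularizedTerm k a := by
  intro a
  obtain ⟨R, hR⟩ := exists_nat_gt ‖a‖
  obtain ⟨M, hM⟩ := exists_norm_regularizedTerm_le R
  have hgeo : Summable fun m : ℕ => M * (1 / 2 : ℝ) ^ m := summable_geometric_two.mul_left M
  have htail : DifferentiableOn ℂ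
      (fun a : ℂ => ∑' m : ℕ, regularizedTerm (m + 20 * (R + 1)) a) (Metric.ball 0 R) :=
    Complex.differentiableOn_tsum_of_summable_norm hgeo
      (fun m => (differentiable_regularizedTerm _).differentiableOn) Metric.isOpen_ball
      (fun m w hw => hM w (by simpa using (mem_ball_zero_iff.1 hw).le) m)
  have hhead : DifferentiableOn ℂ
      (fun a : ℂ => ∑ k ∈ Finset.range (20 * (R + 1)), regularizedTerm k a) (Metric.ball 0 R) :=
    DifferentiableOn.fun_sum fun k _ => (differentiable_regularizedTerm k).differentiableOn
  have hsplit : DifferentiableOn ℂ (fun a : ℂ => ∑' k : ℕ, regularizedTerm k a)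
      (Metric.ball 0 R) := by
    refine (hhead.add htail).congr fun w hw => ?_
    have hs : Summable fun m : ℕ => regularizedTerm (m + 20 * (R + 1)) w :=
      Summable.of_norm_bounded hgeo (hM w (by simpa using (mem_ball_zero_iff.1 hw).le))
    exact (((summable_nat_add_iff (f := fun k => regularizedTerm k w) _).1 hs).sum_add_tsum_nat_add
      _).symm
  exact hsplit.differentiableAt (Metric.isOpen_ball.mem_nhds (by simpa using hR))

lemma regularizedTerm_ofReal (k : ℕ) (a : ℝ) :
    regularizedTerm k a = (((ascPochhammer ℝ k).eval a * (ascPochhammer ℝ k).eval (a + 1 / 2) /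
        (Nat.factorial k : ℝ) / Gamma (7 / 2 - 2 * a + k) * (-1 / 3) ^ k : ℝ) : ℂ) := by
  have h : ∀ x : ℝ, (ascPochhammer ℂ k).eval (x : ℂ) = (((ascPochhammer ℝ k).eval x : ℝ) : ℂ) :=
    fun x => by
      rw [← ascPochhammer_map (algebraMap ℝ ℂ), ← Complex.coe_algebraMap,
        Polynomial.eval_map_algebraMap, Polynomial.aeval_algebraMap_apply]
      simp
  have h2 := h (a + 1 / 2)
  have h3 := Complex.Gamma_ofReal (7 / 2 - 2 * a + k)
  push_cast at h2 h3
  rw [regularizedTerm, h a, h2, h3]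
  push_cast
  ring

/-- Analytic continuation in `a` of the evaluation of the regularized series. -/
lemma tsum_regularizedTerm (a : ℂ) :
    (1 - 2 * a) * ∑' k : ℕ, regularizedTerm k a =
      ((32 / 9 / √π : ℝ) : ℂ) * ((9 / 8 : ℝ) : ℂ) ^ (2 * a) *
        ((Gamma (4 / 3) : ℂ) * (Complex.Gamma (7 / 3 - 2 * a))⁻¹ -
          (Gamma (5 / 3) : ℂ) * (Complex.Gamma (8 / 3 - 2 * a))⁻¹) := by
  have hb : ((9 / 8 : ℝ) : ℂ) ≠ 0 := by norm_num
  have hL : Differentiable ℂ fun a : ℂ => (1 - 2 * a) * ∑' k : ℕ, regularizedTerm k a :=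
    Differentiable.mul (by fun_prop) differentiable_tsum_regularizedTerm
  have hR : Differentiable ℂ fun a : ℂ => ((32 / 9 / √π : ℝ) : ℂ) * ((9 / 8 : ℝ) : ℂ) ^ (2 * a) *
        ((Gamma (4 / 3) : ℂ) * (Complex.Gamma (7 / 3 - 2 * a))⁻¹ -
          (Gamma (5 / 3) : ℂ) * (Complex.Gamma (8 / 3 - 2 * a))⁻¹) := by
    have h1 : Differentiable ℂ fun a : ℂ => (Complex.Gamma (7 / 3 - 2 * a))⁻¹ :=
      Complex.differentiable_one_div_Gamma.comp (by fun_prop)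
    have h2 : Differentiable ℂ fun a : ℂ => (Complex.Gamma (8 / 3 - 2 * a))⁻¹ :=
      Complex.differentiable_one_div_Gamma.comp (by fun_prop)
    have h3 : Differentiable ℂ fun a : ℂ => ((9 / 8 : ℝ) : ℂ) ^ (2 * a) :=
      Differentiable.const_cpow (by fun_prop) (Or.inl hb)
    exact (h3.const_mul _).mul ((h1.const_mul _).sub (h2.const_mul _))
  have hreal : ∀ x : ℝ, x < 0 → (1 - 2 * (x : ℂ)) * ∑' k : ℕ, regularizedTerm k x =
      ((32 / 9 / √π : ℝ) : ℂ) * ((9 / 8 : ℝ) : ℂ) ^ (2 * (x : ℂ)) *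
        ((Gamma (4 / 3) : ℂ) * (Complex.Gamma (7 / 3 - 2 * x))⁻¹ -
          (Gamma (5 / 3) : ℂ) * (Complex.Gamma (8 / 3 - 2 * x))⁻¹) := by
    intro x hx
    have h := congrArg (fun y : ℝ => (y : ℂ)) (tsum_regularized_of_neg hx)
    have e1 := Complex.Gamma_ofReal (7 / 3 - 2 * x)
    have e2 := Complex.Gamma_ofReal (8 / 3 - 2 * x)
    have e3 := Complex.ofReal_cpow (x := 9 / 8) (by norm_num) (2 * x)
    rw [Complex.ofReal_mul (2 : ℝ)] at e3
    push_cast at e1 e2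
    simp only [regularizedTerm_ofReal, ← Complex.ofReal_tsum]
    rw [e1, e2]
    rw [Complex.ofReal_ofNat] at e3
    rw [← e3]
    simpa only [Complex.ofReal_mul, Complex.ofReal_sub, Complex.ofReal_one, Complex.ofReal_ofNat,
      Complex.ofReal_inv, div_eq_mul_inv (Gamma _)] using h
  have hfreq : ∃ᶠ z in nhdsWithin (-1 : ℂ) {(-1 : ℂ)}ᶜ,
      (1 - 2 * z) * ∑' k : ℕ, regularizedTerm k z =
      ((32 / 9 / √π : ℝ) : ℂ) * ((9 / 8 : ℝ) : ℂ) ^ (2 * z) *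
        ((Gamma (4 / 3) : ℂ) * (Complex.Gamma (7 / 3 - 2 * z))⁻¹ -
          (Gamma (5 / 3) : ℂ) * (Complex.Gamma (8 / 3 - 2 * z))⁻¹) := by
    have ht : Filter.Tendsto (fun x : ℝ => (x : ℂ)) (nhdsWithin (-1) {(-1 : ℝ)}ᶜ)
        (nhdsWithin (-1 : ℂ) {(-1 : ℂ)}ᶜ) := by
      refine tendsto_nhdsWithin_iff.2 ⟨?_, ?_⟩
      · have h : Filter.Tendsto (fun x : ℝ => (x : ℂ)) (nhds (-1)) (nhds ((-1 : ℝ) : ℂ)) :=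
          Complex.continuous_ofReal.tendsto (-1)
        rw [Complex.ofReal_neg, Complex.ofReal_one] at h
        exact h.mono_left nhdsWithin_le_nhds
      · filter_upwards [self_mem_nhdsWithin] with x hx h
        have h' : (x : ℂ) = ((-1 : ℝ) : ℂ) := by simpa using h
        exact hx (Complex.ofReal_injective h')
    refine ht.frequently (Filter.Eventually.frequently ?_)
    filter_upwards [mem_nhdsWithin_of_mem_nhds (Iio_mem_nhds (show (-1 : ℝ) < 0 by norm_num))]
      with x hx using hreal x hx
  exact congrFun (AnalyticOnNhd.eq_of_frequently_eq
    (fun z _ => hL.analyticAt z) (fun z _ => hR.analyticAt z) hfreq) a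

lemma tsum_regularized (a : ℝ) :
    (1 - 2 * a) * ∑' k : ℕ, (ascPochhammer ℝ k).eval a * (ascPochhammer ℝ k).eval (a + 1 / 2) /
        (Nat.factorial k : ℝ) / Gamma (7 / 2 - 2 * a + k) * (-1 / 3) ^ k =
      32 / 9 / √π * (9 / 8) ^ (2 * a) *
        (Gamma (4 / 3) / Gamma (7 / 3 - 2 * a) - Gamma (5 / 3) / Gamma (8 / 3 - 2 * a)) := by
  have h := tsum_regularizedTerm a
  have e1 := Complex.Gamma_ofReal (7 / 3 - 2 * a)
  have e2 := Complex.Gamma_ofReal (8 / 3 - 2 * a)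
  have e3 := Complex.ofReal_cpow (x := 9 / 8) (by norm_num) (2 * a)
  rw [Complex.ofReal_mul (2 : ℝ), Complex.ofReal_ofNat] at e3
  push_cast at e1 e2
  simp only [regularizedTerm_ofReal, ← Complex.ofReal_tsum] at h
  rw [e1, e2, ← e3] at h
  rw [← Complex.ofReal_inj]
  simpa only [Complex.ofReal_mul, Complex.ofReal_sub, Complex.ofReal_one, Complex.ofReal_ofNat,
    Complex.ofReal_inv, div_eq_mul_inv (Gamma _)] using h

lemma Gamma_add_nat_eq_ascPochhammer {c : ℝ} (hc : ∀ k : ℕ, c ≠ -k) (k : ℕ) :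
    Gamma (c + k) = (ascPochhammer ℝ k).eval c * Gamma c := by
  induction k with
  | zero => simp
  | succ k ih =>
    rw [ascPochhammer_succ_eval, Nat.cast_succ, ← add_assoc,
      Gamma_add_one fun h => hc k (by linarith), ih]
    ring

/-- The quotient of the two closed forms, by the duplication and triplication formulas. -/
lemma Gamma_mul_closed_form {A : ℝ} (h1 : A ≠ 1) (h4 : ∀ k : ℕ, 6 - 3 * A ≠ -(k : ℝ))
    (h2 : ∀ k : ℕ, 8 / 3 - A ≠ -(k : ℝ)) (h3 : ∀ k : ℕ, 7 / 3 - A ≠ -(k : ℝ)) :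
    Gamma (7 / 2 - A) * (32 / 9 / √π * (9 / 8) ^ A *
        (Gamma (4 / 3) / Gamma (7 / 3 - A) - Gamma (5 / 3) / Gamma (8 / 3 - A))) =
      (1 - A) * (6 ^ (1 - A) / ((1 - A) * (2 - A)) *
        (Gamma (8 / 3 - A) / Gamma (5 / 3) - Gamma (7 / 3 - A) / Gamma (4 / 3)) *
          (Gamma (6 - 2 * A) / Gamma (6 - 3 * A))) := by
  have hA : 2 - A ≠ 0 := fun h => h4 0 (by push_cast; linarith)
  have h1' : 1 - A ≠ 0 := sub_ne_zero.2 h1.symm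
  have htri := Gamma_triplication (s := 2 - A) fun k hk => h4 k (by linarith)
  have hdup := Gamma_mul_Gamma_add_half (3 - A)
  rw [show 3 - A = 2 - A + 1 by ring, Gamma_add_one hA,
    show 2 - A + 1 + 1 / 2 = 7 / 2 - A by ring, show 2 * (2 - A + 1) = 6 - 2 * A by ring,
    show 1 - (6 - 2 * A) = 2 * A + -5 by ring] at hdup
  rw [show 2 - A + 1 / 3 = 7 / 3 - A by ring, show 2 - A + 2 / 3 = 8 / 3 - A by ring,
    show 3 * (2 - A) = 6 - 3 * A by ring, show 1 - (6 - 3 * A) = 3 * A + -5 by ring] at htri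
  have hg1 : Gamma (4 / 3) = 1 / 3 * Gamma (1 / 3) := by
    rw [← Gamma_add_one (by norm_num)]; norm_num
  have hg2 : Gamma (5 / 3) = 2 / 3 * Gamma (2 / 3) := by
    rw [← Gamma_add_one (by norm_num)]; norm_num
  have p1 : (0 : ℝ) < Gamma (1 / 3) := Gamma_pos_of_pos (by norm_num)
  have p2 : (0 : ℝ) < Gamma (2 / 3) := Gamma_pos_of_pos (by norm_num)
  have n1 := Gamma_ne_zero h2
  have n2 := Gamma_ne_zero h3
  have n3 := Gamma_ne_zero h4
  have n4 : Gamma (2 - A) ≠ 0 := Gamma_ne_zero fun k hk => h4 (3 * k) (by push_cast; linarith)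
  have hπ : √π ≠ 0 := (sqrt_pos.2 pi_pos).ne'
  have hx : (0 : ℝ) < 2 ^ A := by positivity
  have hy : (0 : ℝ) < 3 ^ A := by positivity
  have e2 : (2 : ℝ) ^ (2 * A + -5) = (2 ^ A) ^ 2 / 32 := by
    rw [rpow_add two_pos, mul_comm 2 A, rpow_mul zero_le_two, rpow_ofNat, rpow_neg zero_le_two,
      rpow_ofNat]
    norm_num [div_eq_mul_inv]
  have e3 : (3 : ℝ) ^ (3 * A + -5) = (3 ^ A) ^ 3 / 243 := by
    rw [rpow_add three_pos, mul_comm 3 A, rpow_mul zero_le_three, rpow_ofNat,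
      rpow_neg zero_le_three, rpow_ofNat]
    norm_num [div_eq_mul_inv]
  have e6 : (6 : ℝ) ^ (1 - A) = 6 / (2 ^ A * 3 ^ A) := by
    rw [rpow_sub (by norm_num), rpow_one, ← mul_rpow zero_le_two zero_le_three]
    norm_num
  have e98 : (9 / 8 : ℝ) ^ A = (3 ^ A) ^ 2 / (2 ^ A) ^ 3 := by
    rw [div_rpow (by norm_num) (by norm_num), ← rpow_natCast, ← rpow_natCast,
      ← rpow_mul zero_le_three, ← rpow_mul zero_le_two, mul_comm A, mul_comm A,
      rpow_mul zero_le_three, rpow_mul zero_le_two]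
    norm_num
  rw [e2] at hdup
  rw [e3] at htri
  rw [e6, e98, hg1, hg2]
  have hdup' : Gamma (7 / 2 - A) =
      Gamma (6 - 2 * A) * ((2 ^ A) ^ 2 / 32) * √π / ((2 - A) * Gamma (2 - A)) := by
    rw [eq_div_iff (mul_ne_zero hA n4), ← hdup]
    ring
  have htri' : Gamma (6 - 3 * A) = Gamma (2 - A) * Gamma (7 / 3 - A) * Gamma (8 / 3 - A) * 243 /
      ((3 ^ A) ^ 3 * (Gamma (1 / 3) * Gamma (2 / 3))) := by
    rw [eq_div_iff (by positivity), htri]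
    ring
  rw [hdup', htri']
  clear hdup htri hdup' htri' n3 hg1 hg2
  generalize Gamma (8 / 3 - A) = u at *
  generalize Gamma (7 / 3 - A) = v at *
  generalize Gamma (1 / 3) = g at *
  generalize Gamma (2 / 3) = h at *
  generalize Gamma (2 - A) = w at *
  field_simp
  ring

theorem gauss_2F1_special_value_c (a : ℝ) (ha1 : a ≠ 1 / 2) (ha2 : a ≠ 1)
    (h1 : ∀ k : ℕ, (7 / 2 : ℝ) - 2 * a ≠ -(k : ℝ))
    (h2 : ∀ k : ℕ, (8 / 3 : ℝ) - 2 * a ≠ -(k : ℝ))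
    (h3 : ∀ k : ℕ, (7 / 3 : ℝ) - 2 * a ≠ -(k : ℝ))
    (h4 : ∀ k : ℕ, (6 : ℝ) - 6 * a ≠ -(k : ℝ)) :
    ∑' k : ℕ, (ascPochhammer ℝ k).eval a * (ascPochhammer ℝ k).eval (a + 1 / 2) /
        ((ascPochhammer ℝ k).eval (7 / 2 - 2 * a) * (Nat.factorial k : ℝ)) *
        (-1 / 3 : ℝ) ^ k
      = (6 : ℝ) ^ (1 - 2 * a) / ((1 - 2 * a) * (2 - 2 * a)) *
          (Real.Gamma (8 / 3 - 2 * a) / Real.Gamma (5 / 3) -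
            Real.Gamma (7 / 3 - 2 * a) / Real.Gamma (4 / 3)) *
          (Real.Gamma (6 - 4 * a) / Real.Gamma (6 - 6 * a)) := by
  have hA : 2 * a ≠ 1 := fun h => ha1 (by linarith)
  have hA' : 1 - 2 * a ≠ 0 := sub_ne_zero.2 hA.symm
  have hterm : ∀ k : ℕ, (ascPochhammer ℝ k).eval a * (ascPochhammer ℝ k).eval (a + 1 / 2) /
      ((ascPochhammer ℝ k).eval (7 / 2 - 2 * a) * (Nat.factorial k : ℝ)) * (-1 / 3 : ℝ) ^ k =
      Gamma (7 / 2 - 2 * a) * ((ascPochhammer ℝ k).eval a *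
        (ascPochhammer ℝ k).eval (a + 1 / 2) / (Nat.factorial k : ℝ) /
          Gamma (7 / 2 - 2 * a + k) * (-1 / 3) ^ k) := fun k => by
    have hg := Gamma_ne_zero h1
    have hp : (ascPochhammer ℝ k).eval (7 / 2 - 2 * a) ≠ 0 := fun h => by
      refine Gamma_ne_zero (s := 7 / 2 - 2 * a + k)
        (fun m hm => h1 (m + k) (by push_cast; linarith)) ?_
      rw [Gamma_add_nat_eq_ascPochhammer h1, h, zero_mul]
    rw [Gamma_add_nat_eq_ascPochhammer h1]
    generalize Gamma (7 / 2 - 2 * a) = g at *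
    generalize (ascPochhammer ℝ k).eval (7 / 2 - 2 * a) = p at *
    field_simp
  have hclosed := Gamma_mul_closed_form (A := 2 * a) hA
    (fun k hk => h4 k (by linarith)) h2 h3
  rw [show 6 - 2 * (2 * a) = 6 - 4 * a by ring, show 6 - 3 * (2 * a) = 6 - 6 * a by ring,
    ← tsum_regularized a] at hclosed
  rw [tsum_congr hterm, tsum_mul_left]
  refine mul_left_cancel₀ hA' (Eq.trans ?_ hclosed)
  ring
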